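/- arXiv:2111.08526 — 7 statements merged into one kernel-verified Lean document; each statement's English description precedes it below -/
import Mathlib

section
/- Let (X, Σ, μ) be a complete σ-finite measure space with μ ≠ 0. Then there exists a von Neumann lifting ℓ of μ. -/
open MeasureTheory Set

/-- A von Neumann lifting of a measure `μ`: a Boolean homomorphism `ℓ : Σ → Σ` selecting
a.e.-representatives. -/
structure IsVNLifting {X : Type*} [MeasurableSpace X] (μ : MeasureTheory.Measure X)
    (ℓ : Set X → Set X) : Prop where
  measurableSet : ∀ E : Set X, MeasurableSet E → MeasurableSet (ℓ E)
  map_empty : ℓ (∅ : Set X) = ∅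
  map_univ : ℓ (Set.univ : Set X) = Set.univ
  map_inter : ∀ E F : Set X, MeasurableSet E → MeasurableSet F → ℓ (E ∩ F) = ℓ E ∩ ℓ F
  map_union : ∀ E F : Set X, MeasurableSet E → MeasurableSet F → ℓ (E ∪ F) = ℓ E ∪ ℓ F
  congr_ae : ∀ E F : Set X, MeasurableSet E → MeasurableSet F →
    μ (symmDiff E F) = 0 → ℓ E = ℓ F
  ae_symmDiff : ∀ E : Set X, MeasurableSet E → μ (symmDiff E (ℓ E)) = 0

open Filter Topology

/-- A lower density of `μ` on the sub-σ-algebra `m`: a selection of a.e.-representatives that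
preserves `∅`, `univ` and binary intersections. -/
structure IsLowerDensity_s0 {X : Type*} {m0 : MeasurableSpace X} (μ : Measure X)
    (m : MeasurableSpace X) (φ : Set X → Set X) : Prop where
  measurableSet : ∀ E, MeasurableSet[m] E → MeasurableSet[m] (φ E)
  map_empty : φ ∅ = ∅
  map_univ : φ univ = univ
  map_inter : ∀ E F, MeasurableSet[m] E → MeasurableSet[m] F → φ (E ∩ F) = φ E ∩ φ F
  congr_ae : ∀ E F, MeasurableSet[m] E → MeasurableSet[m] F →
    (∀ᵐ x ∂μ, x ∈ E ↔ x ∈ F) → φ E = φ F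
  ae_mem_iff : ∀ E, MeasurableSet[m] E → ∀ᵐ x ∂μ, x ∈ φ E ↔ x ∈ E

namespace IsLowerDensity_s0

variable {X : Type*} {m0 : MeasurableSpace X} {μ : Measure X} {φ : Set X → Set X}

theorem mono_ae {m : MeasurableSpace X} (h : IsLowerDensity_s0 μ m φ) {E F : Set X}
    (hE : MeasurableSet[m] E) (hF : MeasurableSet[m] F) (hEF : ∀ᵐ x ∂μ, x ∈ E → x ∈ F) : φ E ⊆ φ F := by
  have h1 : φ (E ∩ F) = φ E := h.congr_ae _ _ (hE.inter hF) hE <| by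
    filter_upwards [hEF] with x hx
    exact ⟨fun h => h.1, fun h => ⟨h, hx h⟩⟩
  rw [← h1, h.map_inter _ _ hE hF]
  exact inter_subset_right

theorem id_bot (hμ : μ ≠ 0) : IsLowerDensity_s0 μ ⊥ id where
  measurableSet _ hE := hE
  map_empty := rfl
  map_univ := rfl
  map_inter _ _ _ _ := rfl
  congr_ae E F hE hF h := by
    have : (ae μ).NeBot := ae_neBot.2 hμ
    obtain ⟨x, hx⟩ := h.exists
    rcases MeasurableSpace.measurableSet_bot_iff.1 hE with rfl | rfl <;>
      rcases MeasurableSpace.measurableSet_bot_iff.1 hF with rfl | rfl <;> simp_all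
  ae_mem_iff _ _ := by simp

/-- On a complete measure space, refining at every point the filter given by a lower density to
an ultrafilter produces a lifting. -/
theorem exists_isVNLifting (hc : μ.IsComplete) (h : IsLowerDensity_s0 μ m0 φ) :
    ∃ ℓ : Set X → Set X, IsVNLifting μ ℓ := by
  let 𝓕 : X → Filter X := fun x =>
    { sets := {S | ∃ E, MeasurableSet E ∧ x ∈ φ E ∧ E ⊆ S}
      univ_sets := ⟨univ, .univ, by simp [h.map_univ], subset_rfl⟩
      sets_of_superset := by
        rintro S T ⟨E, hE, hx, hS⟩ hST
        exact ⟨E, hE, hx, hS.trans hST⟩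
      inter_sets := by
        rintro S T ⟨E, hE, hx, hS⟩ ⟨F, hF, hy, hT⟩
        exact ⟨E ∩ F, hE.inter hF, by rw [h.map_inter _ _ hE hF]; exact ⟨hx, hy⟩,
          inter_subset_inter hS hT⟩ }
  have mem_𝓕 : ∀ {x E}, MeasurableSet E → x ∈ φ E → E ∈ 𝓕 x :=
    fun hE hx => ⟨_, hE, hx, subset_rfl⟩
  have neBot : ∀ x, (𝓕 x).NeBot := by
    refine fun x => neBot_iff.2 fun hbot => ?_
    obtain ⟨E, hE, hx, hE'⟩ : ∅ ∈ 𝓕 x := hbot ▸ mem_bot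
    rw [subset_empty_iff.1 hE', h.map_empty] at hx
    exact hx
  let U : X → Ultrafilter X := fun x => Ultrafilter.of (𝓕 x)
  have mem_U : ∀ {x E}, MeasurableSet E → x ∈ φ E → E ∈ U x :=
    fun hE hx => Ultrafilter.of_le _ (mem_𝓕 hE hx)
  have ae_U : ∀ E, MeasurableSet E → ∀ᵐ x ∂μ, x ∈ E ↔ E ∈ U x := by
    intro E hE
    filter_upwards [h.ae_mem_iff E hE, h.ae_mem_iff Eᶜ hE.compl] with x h1 h2
    refine ⟨fun hx => mem_U hE (h1.2 hx), fun hx => ?_⟩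
    by_contra hxE
    exact Ultrafilter.compl_mem_iff_notMem.1 (mem_U hE.compl (h2.2 hxE)) hx
  refine ⟨fun E => {x | E ∈ U x}, ?_, ?_, ?_, ?_, ?_, ?_, ?_⟩
  · intro E hE
    have : {x | E ∈ U x} =ᵐ[μ] E := by
      filter_upwards [ae_U E hE] with x hx
      exact propext hx.symm
    exact (NullMeasurableSet.congr hE.nullMeasurableSet this.symm).measurable_of_complete
  · exact eq_empty_of_forall_notMem fun _ hx => Ultrafilter.empty_notMem hx
  · exact eq_univ_of_forall fun x => (univ_mem : univ ∈ (U x : Filter X))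
  · intro E F _ _
    ext x
    exact inter_mem_iff
  · intro E F _ _
    ext x
    exact Ultrafilter.union_mem_iff
  · intro E F hE hF hEF
    have hD : MeasurableSet (symmDiff E F)ᶜ := (hE.symmDiff hF).compl
    ext x
    have hx : (symmDiff E F)ᶜ ∈ U x := by
      refine mem_U hD ?_
      rw [h.congr_ae _ univ hD .univ, h.map_univ]
      · trivial
      · filter_upwards [measure_eq_zero_iff_ae_notMem.1 hEF] with x hx
        exact iff_of_true hx (mem_univ x)
    constructor <;> intro hx' <;> filter_upwards [hx, hx'] with y hy hy' <;> by_contra hn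
    · exact hy (Or.inl ⟨hy', hn⟩)
    · exact hy (Or.inr ⟨hy', hn⟩)
  · intro E hE
    rw [measure_eq_zero_iff_ae_notMem]
    filter_upwards [ae_U E hE] with x hx
    simp only [mem_symmDiff, mem_ofPred_eq]
    tauto

end IsLowerDensity_s0

section Extension

variable {X : Type*} {m0 : MeasurableSpace X} {μ : Measure X} [IsFiniteMeasure μ]
  {m : MeasurableSpace X}

/-- Every measurable set has an essential hull in a given sub-σ-algebra. -/
theorem exists_essential_hull (hm : m ≤ m0) {A : Set X} (hA : MeasurableSet[m0] A) :
    ∃ H, MeasurableSet[m] H ∧ (∀ᵐ x ∂μ, x ∈ A → x ∈ H) ∧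
      ∀ N, MeasurableSet[m] N → (∀ᵐ x ∂μ, x ∈ N → x ∉ A) → ∀ᵐ x ∂μ, x ∈ N → x ∉ H := by
  set f : X → ℝ := A.indicator fun _ => 1
  have hf : Integrable f μ := (integrable_const 1).indicator hA
  have hf0 : 0 ≤ f := indicator_nonneg fun _ _ => zero_le_one
  have hP0 : 0 ≤ᵐ[μ] μ[f|m] := condExp_nonneg (.of_forall hf0)
  have hH : MeasurableSet[m] {x | (μ[f|m]) x ≠ 0} :=
    (stronglyMeasurable_condExp.measurable (measurableSet_singleton 0)).compl
  refine ⟨{x | (μ[f|m]) x ≠ 0}, hH, ?_, fun N hN hNA => ?_⟩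
  · have h1 := setIntegral_condExp hm hf hH.compl
    rw [setIntegral_congr_fun (g := 0) (hm _ hH.compl) fun x hx => by simpa using hx] at h1
    simp only [Pi.zero_apply, integral_zero] at h1
    have h2 := (setIntegral_eq_zero_iff_of_nonneg_ae (.of_forall hf0) hf.integrableOn).1 h1.symm
    rw [EventuallyEq, ae_restrict_iff' (hm _ hH.compl)] at h2
    filter_upwards [h2] with x hx hxA
    by_contra hxH
    simpa [f, hxA] using hx (not_not.2 hxH)
  · have h1 := setIntegral_condExp hm hf hN
    have h2 : ∫ x in N, f x ∂μ = 0 := by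
      rw [setIntegral_congr_ae (g := 0) (hm _ hN), Pi.zero_def, integral_zero]
      filter_upwards [hNA] with x hx hxN
      simp [f, hx hxN]
    rw [h2] at h1
    have h3 := (setIntegral_eq_zero_iff_of_nonneg_ae (ae_restrict_of_ae hP0)
      integrable_condExp.integrableOn).1 h1
    rw [EventuallyEq, ae_restrict_iff' (hm _ hN)] at h3
    filter_upwards [h3] with x hx hxN
    simpa using hx hxN

/-- The σ-algebra generated by `m` and one more set `A`. -/
@[reducible]
def MeasurableSpace.adjoin (m : MeasurableSpace X) (A : Set X) : MeasurableSpace X where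
  MeasurableSet' S := ∃ E F, MeasurableSet[m] E ∧ MeasurableSet[m] F ∧ S = A.ite E F
  measurableSet_empty := ⟨∅, ∅, .empty, .empty, by simp⟩
  measurableSet_compl := by
    rintro _ ⟨E, F, hE, hF, rfl⟩
    refine ⟨Eᶜ, Fᶜ, hE.compl, hF.compl, ?_⟩
    ext x
    by_cases hx : x ∈ A <;> simp [Set.ite, hx]
  measurableSet_iUnion := by
    intro f hf
    choose E F hE hF hf using hf
    refine ⟨⋃ i, E i, ⋃ i, F i, .iUnion hE, .iUnion hF, ?_⟩
    ext x
    by_cases hx : x ∈ A <;> simp [Set.ite, hx, hf]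

theorem IsLowerDensity_s0.exists_adjoin (hm : m ≤ m0) {φ : Set X → Set X}
    (h : IsLowerDensity_s0 μ m φ) {A : Set X} (hA : MeasurableSet[m0] A) :
    ∃ ψ, IsLowerDensity_s0 μ (m.adjoin A) ψ ∧ ∀ E, MeasurableSet[m] E → φ E = ψ E := by
  obtain ⟨H, hH, hAH, hHmin⟩ := exists_essential_hull (μ := μ) hm hA
  obtain ⟨G, hG, hAG, hGmin⟩ := exists_essential_hull (μ := μ) hm hA.compl
  have mite : ∀ {B E F : Set X}, MeasurableSet[m] B → MeasurableSet[m] E →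
      MeasurableSet[m] F → MeasurableSet[m] (B.ite E F) := fun hB hE hF =>
    (hE.inter hB).union (hF.diff hB)
  have hchoice : ∀ S, MeasurableSet[m.adjoin A] S →
    ∃ E F, MeasurableSet[m] E ∧ MeasurableSet[m] F ∧ S = A.ite E F := fun _ h => h
  choose! E F hE hF hS using hchoice
  set ψ : Set X → Set X := fun S =>
    A.ite (φ (H.ite (E S) (F S))) (φ (Gᶜ.ite (E S) (F S))) with hψ
  have ite_iff : ∀ (B P Q : Set X) x, x ∈ B.ite P Q ↔ (x ∈ B ∧ x ∈ P) ∨ (x ∉ B ∧ x ∈ Q) := by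
    intro B P Q x
    simp only [Set.ite, mem_union, mem_inter_iff, Set.mem_sdiff]
    tauto
  have key : ∀ S P Q, MeasurableSet[m.adjoin A] S → MeasurableSet[m] P → MeasurableSet[m] Q →
      (∀ᵐ x ∂μ, x ∈ S ↔ x ∈ A.ite P Q) → ψ S = A.ite (φ (H.ite P Q)) (φ (Gᶜ.ite P Q)) := by
    intro S P Q hSm hP hQ hSPQ
    have e1 := hHmin _ ((hE S hSm).symmDiff hP) <| by
      filter_upwards [hSPQ] with x hx
      rw [hS S hSm, ite_iff, ite_iff] at hx
      rw [mem_symmDiff]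
      grind only
    have e2 := hGmin _ ((hF S hSm).symmDiff hQ) <| by
      filter_upwards [hSPQ] with x hx
      rw [hS S hSm, ite_iff, ite_iff] at hx
      rw [mem_symmDiff, mem_compl_iff]
      grind only
    simp only [hψ]
    congr 1
    · refine h.congr_ae _ _ (mite hH (hE S hSm) (hF S hSm)) (mite hH hP hQ) ?_
      filter_upwards [hSPQ, e1, hAH] with x hx h1 h2
      rw [hS S hSm, ite_iff, ite_iff] at hx
      rw [mem_symmDiff] at h1
      rw [ite_iff, ite_iff]
      grind only
    · refine h.congr_ae _ _ (mite hG.compl (hE S hSm) (hF S hSm)) (mite hG.compl hP hQ) ?_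
      filter_upwards [hSPQ, e2, hAG] with x hx h1 h2
      rw [hS S hSm, ite_iff, ite_iff] at hx
      rw [mem_symmDiff] at h1
      rw [mem_compl_iff] at h2
      rw [ite_iff, ite_iff, mem_compl_iff]
      grind only
  have hle : m ≤ m.adjoin A := fun P hP => ⟨P, P, hP, hP, by simp⟩
  have hext : ∀ P, MeasurableSet[m] P → φ P = ψ P := by
    intro P hP
    rw [key P P P (hle _ hP) hP hP (by simp)]
    simp
  refine ⟨ψ, ⟨?_, ?_, ?_, ?_, ?_, ?_⟩, hext⟩
  · intro S hSm
    exact ⟨_, _, h.measurableSet _ (mite hH (hE S hSm) (hF S hSm)),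
      h.measurableSet _ (mite hG.compl (hE S hSm) (hF S hSm)), rfl⟩
  · rw [← hext _ (@MeasurableSet.empty _ m), h.map_empty]
  · rw [← hext _ (@MeasurableSet.univ _ m), h.map_univ]
  · intro S T hSm hTm
    rw [key (S ∩ T) (E S ∩ E T) (F S ∩ F T) (hSm.inter hTm) ((hE S hSm).inter (hE T hTm))
      ((hF S hSm).inter (hF T hTm))]
    · rw [Set.ite_inter_inter, Set.ite_inter_inter,
        h.map_inter _ _ (mite hH (hE S hSm) (hF S hSm)) (mite hH (hE T hTm) (hF T hTm)),
        h.map_inter _ _ (mite hG.compl (hE S hSm) (hF S hSm))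
          (mite hG.compl (hE T hTm) (hF T hTm)), Set.ite_inter_inter]
    · rw [Set.ite_inter_inter, ← hS S hSm, ← hS T hTm]
      simp
  · intro S T hSm hTm hST
    refine key S _ _ hSm (hE T hTm) (hF T hTm) ?_
    rwa [← hS T hTm]
  · intro S hSm
    filter_upwards [hAH, hAG, h.ae_mem_iff _ (mite hH (hE S hSm) (hF S hSm)),
      h.ae_mem_iff _ (mite hG.compl (hE S hSm) (hF S hSm))] with x h1 h2 h3 h4
    rw [ite_iff] at h3 h4
    rw [mem_compl_iff] at h2 h4
    conv_rhs => rw [hS S hSm]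
    simp only [hψ]
    rw [ite_iff, ite_iff, h3, h4]
    grind only

end Extension

section Limit

variable {X : Type*} {m0 : MeasurableSpace X} {μ : Measure X} [IsFiniteMeasure μ]

/-- Compatible lower densities on an increasing sequence of σ-algebras have a common extension to
the σ-algebra generated by the union, by Lévy's upward theorem. -/
theorem IsLowerDensity_s0.exists_iSup_nat (ℱ : Filtration ℕ m0) (φ : ℕ → Set X → Set X)
    (h : ∀ n, IsLowerDensity_s0 μ (ℱ n) (φ n))
    (hφ : ∀ i j, i ≤ j → ∀ E, MeasurableSet[ℱ i] E → φ i E = φ j E) :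
    ∃ ψ, IsLowerDensity_s0 μ (⨆ n, ℱ n) ψ ∧ ∀ n E, MeasurableSet[ℱ n] E → φ n E = ψ E := by
  have hsup : (⨆ n, ℱ n) ≤ m0 := iSup_le ℱ.le
  let P : ℕ → Set X → X → ℝ := fun n E => μ[E.indicator fun _ => (1 : ℝ)|ℱ n]
  let L : ℕ → ℕ → Set X → Set X := fun n k E => {x | 1 - 1 / ((k : ℝ) + 1) < P n E x}
  have hL : ∀ n k E, MeasurableSet[ℱ n] (L n k E) := fun n k E =>
    (stronglyMeasurable_condExp.measurable measurableSet_Ioi)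
  let ψ : Set X → Set X := fun E => {x | ∀ k, ∀ᶠ n in atTop, x ∈ φ n (L n k E)}
  have hint : ∀ {E : Set X}, MeasurableSet[⨆ n, ℱ n] E →
      Integrable (E.indicator fun _ => (1 : ℝ)) μ := fun hE =>
    (integrable_const 1).indicator (hsup _ hE)
  have hext : ∀ n E, MeasurableSet[ℱ n] E → φ n E = ψ E := by
    intro i E hE
    have hLE : ∀ k, ∀ n, i ≤ n → φ n (L n k E) = φ i E := by
      intro k n hn
      rw [hφ i n hn E hE]
      congr 1
      have hPE : P n E = E.indicator fun _ => (1 : ℝ) :=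
        condExp_of_stronglyMeasurable (ℱ.le n)
          (stronglyMeasurable_const.indicator (ℱ.mono hn _ hE)) (hint (le_iSup ℱ i _ hE))
      have hk : 0 < 1 / ((k : ℝ) + 1) := by positivity
      have hk' : 1 / ((k : ℝ) + 1) ≤ 1 := by
        rw [div_le_one (by positivity)]
        linarith [k.cast_nonneg (α := ℝ)]
      ext x
      by_cases hx : x ∈ E
      · simp only [L, hPE, mem_ofPred_eq, indicator_of_mem hx, hx, iff_true]
        linarith
      · simp only [L, hPE, mem_ofPred_eq, indicator_of_notMem hx, hx, iff_false]
        linarith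
    ext x
    constructor
    · intro hx k
      filter_upwards [eventually_ge_atTop i] with n hn
      rwa [hLE k n hn]
    · intro hx
      obtain ⟨n, hn, hin⟩ := ((hx 0).and (eventually_ge_atTop i)).exists
      rwa [hLE 0 n hin] at hn
  have hmono : ∀ {E F : Set X}, MeasurableSet[⨆ n, ℱ n] E → MeasurableSet[⨆ n, ℱ n] F →
      (∀ᵐ x ∂μ, x ∈ E → x ∈ F) → ψ E ⊆ ψ F := by
    intro E F hE hF hEF x hx k
    filter_upwards [hx k] with n hn
    refine (h n).mono_ae (hL _ _ _) (hL _ _ _) ?_ hn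
    have : P n E ≤ᵐ[μ] P n F := by
      refine condExp_mono (hint hE) (hint hF) ?_
      filter_upwards [hEF] with x hx
      by_cases hxE : x ∈ E
      · simp [hxE, hx hxE]
      · simp only [indicator_of_notMem hxE]
        exact indicator_nonneg (fun _ _ => zero_le_one) x
    filter_upwards [this] with x hx hxE
    exact lt_of_lt_of_le hxE hx
  refine ⟨ψ, ⟨?_, ?_, ?_, ?_, ?_, ?_⟩, hext⟩
  · intro E _
    have : ψ E = ⋂ k, ⋃ N, ⋂ n, ⋂ _ : N ≤ n, φ n (L n k E) := by
      ext x
      simp [ψ, eventually_atTop]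
    rw [this]
    exact .iInter fun k => .iUnion fun N => .iInter fun n => .iInter fun _ =>
      le_iSup ℱ n _ ((h n).measurableSet _ (hL n k E))
  · rw [← hext 0 _ (@MeasurableSet.empty _ (ℱ 0)), (h 0).map_empty]
  · rw [← hext 0 _ (@MeasurableSet.univ _ (ℱ 0)), (h 0).map_univ]
  · intro E F hE hF
    refine Subset.antisymm (subset_inter
      (hmono (hE.inter hF) hE (.of_forall fun _ hx => hx.1))
      (hmono (hE.inter hF) hF (.of_forall fun _ hx => hx.2))) ?_
    rintro x ⟨hxE, hxF⟩ k
    filter_upwards [hxE (2 * k + 1), hxF (2 * k + 1)] with n h1 h2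
    have h12 : x ∈ φ n (L n (2 * k + 1) E ∩ L n (2 * k + 1) F) := by
      rw [(h n).map_inter _ _ (hL _ _ _) (hL _ _ _)]
      exact ⟨h1, h2⟩
    refine (h n).mono_ae ((hL _ _ _).inter (hL _ _ _)) (hL _ _ _) ?_ h12
    have hle : P n E + P n F - (fun _ => 1) ≤ᵐ[μ] P n (E ∩ F) := by
      have e1 : μ[(E.indicator fun _ => (1 : ℝ)) + (F.indicator fun _ => 1) - fun _ => 1|ℱ n]
          =ᵐ[μ] P n E + P n F - fun _ => 1 := by
        refine (condExp_sub ((hint hE).add (hint hF)) (integrable_const 1) _).trans ?_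
        rw [condExp_const (ℱ.le n)]
        exact (condExp_add (hint hE) (hint hF) _).sub .rfl
      refine e1.symm.le.trans (condExp_mono (((hint hE).add (hint hF)).sub (integrable_const 1))
        (hint (hE.inter hF)) (.of_forall fun y => ?_))
      by_cases hyE : y ∈ E <;> by_cases hyF : y ∈ F <;> simp [hyE, hyF]
    filter_upwards [hle] with y hy hyEF
    obtain ⟨hyE, hyF⟩ := hyEF
    simp only [L, mem_ofPred_eq, Pi.add_apply, Pi.sub_apply] at hy hyE hyF ⊢
    have hk : 1 / (((2 * k + 1 : ℕ) : ℝ) + 1) = 1 / ((k : ℝ) + 1) / 2 := by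
      push_cast
      field_simp
      ring
    rw [hk] at hyE hyF
    linarith
  · intro E F hE hF hEF
    exact Subset.antisymm (hmono hE hF (hEF.mono fun _ hx => hx.1))
      (hmono hF hE (hEF.mono fun _ hx => hx.2))
  · intro E hE
    have hlim := tendsto_ae_condExp (μ := μ) (ℱ := ℱ) (E.indicator fun _ => (1 : ℝ))
    rw [condExp_of_stronglyMeasurable hsup (stronglyMeasurable_const.indicator hE) (hint hE)]
      at hlim
    have hall : ∀ᵐ x ∂μ, ∀ n k, x ∈ φ n (L n k E) ↔ x ∈ L n k E :=
      ae_all_iff.2 fun n => ae_all_iff.2 fun k => (h n).ae_mem_iff _ (hL n k E)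
    filter_upwards [hlim, hall] with x hx hxL
    simp only [ψ, mem_ofPred_eq, hxL]
    by_cases hxE : x ∈ E
    · simp only [hxE, iff_true]
      intro k
      rw [indicator_of_mem hxE] at hx
      exact hx.eventually (lt_mem_nhds (sub_lt_self _ (by positivity)))
    · simp only [hxE, iff_false, not_forall]
      refine ⟨1, fun hev => ?_⟩
      rw [indicator_of_notMem hxE] at hx
      obtain ⟨n, hn1, hn2⟩ := (hev.and (hx.eventually (gt_mem_nhds one_half_pos))).exists
      simp only [L, mem_ofPred_eq, Nat.cast_one] at hn1
      change P n E x < 1 / 2 at hn2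
      norm_num at hn1 hn2
      linarith

end Limit

section Zorn

variable {X : Type*} {m0 : MeasurableSpace X}

/-- A sub-σ-algebra together with a lower density on it. -/
structure PartialLowerDensity {X : Type*} {m0 : MeasurableSpace X} (μ : Measure X) where
  carrier : MeasurableSpace X
  toFun : Set X → Set X
  carrier_le : carrier ≤ m0
  isLowerDensity : IsLowerDensity_s0 μ carrier toFun

namespace PartialLowerDensity

variable {μ : Measure X}

/-- `q` extends `p`. -/
def Extends (p q : PartialLowerDensity μ) : Prop :=
  p.carrier ≤ q.carrier ∧ ∀ E, MeasurableSet[p.carrier] E → p.toFun E = q.toFun E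

theorem Extends.refl (p : PartialLowerDensity μ) : Extends p p := ⟨le_rfl, fun _ _ => rfl⟩

theorem Extends.trans {p q r : PartialLowerDensity μ} (h : Extends p q) (h' : Extends q r) :
    Extends p r :=
  ⟨h.1.trans h'.1, fun E hE => (h.2 E hE).trans (h'.2 E (h.1 E hE))⟩

theorem exists_upper_bound_seq [IsFiniteMeasure μ] (p : ℕ → PartialLowerDensity μ)
    (hp : ∀ n, Extends (p n) (p (n + 1))) : ∃ q, ∀ n, Extends (p n) q := by
  have hmono : ∀ i j, i ≤ j → Extends (p i) (p j) := fun i j hij =>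
    Nat.le_induction (.refl _) (fun n _ h => h.trans (hp n)) j hij
  let ℱ : Filtration ℕ m0 := ⟨fun n => (p n).carrier, fun i j hij => (hmono i j hij).1,
    fun n => (p n).carrier_le⟩
  obtain ⟨ψ, hψ, hext⟩ := IsLowerDensity_s0.exists_iSup_nat (μ := μ) ℱ (fun n => (p n).toFun)
    (fun n => (p n).isLowerDensity) fun i j hij => (hmono i j hij).2
  exact ⟨⟨⨆ n, ℱ n, ψ, iSup_le ℱ.le, hψ⟩, fun n => ⟨le_iSup ℱ n, hext n⟩⟩

theorem exists_upper_bound_of_countably_directed {c : Set (PartialLowerDensity μ)}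
    (hc : ∀ s ⊆ c, s.Countable → ∃ q ∈ c, ∀ p ∈ s, Extends p q) :
    ∃ q, ∀ p ∈ c, Extends p q := by
  have hc2 : ∀ p ∈ c, ∀ q ∈ c, ∃ r ∈ c, Extends p r ∧ Extends q r := by
    intro p hp q hq
    obtain ⟨r, hr, h⟩ := hc {p, q} (pair_subset hp hq) (by simp)
    exact ⟨r, hr, h p (by simp), h q (by simp)⟩
  obtain ⟨p₀, hp₀, -⟩ := hc ∅ (empty_subset _) countable_empty
  let m : MeasurableSpace X :=
    { MeasurableSet' := fun E => ∃ p ∈ c, MeasurableSet[p.carrier] E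
      measurableSet_empty := ⟨p₀, hp₀, @MeasurableSet.empty _ p₀.carrier⟩
      measurableSet_compl := by
        rintro E ⟨p, hp, hE⟩
        exact ⟨p, hp, hE.compl⟩
      measurableSet_iUnion := by
        intro f hf
        choose p hp hf using hf
        obtain ⟨q, hq, hpq⟩ := hc (range p) (range_subset_iff.2 hp) (countable_range p)
        exact ⟨q, hq, .iUnion fun i => (hpq _ (mem_range_self i)).1 _ (hf i)⟩ }
  have hm : ∀ E, MeasurableSet[m] E → ∃ p ∈ c, MeasurableSet[p.carrier] E := fun _ h => h
  have hm2 : ∀ E F, MeasurableSet[m] E → MeasurableSet[m] F →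
      ∃ p ∈ c, MeasurableSet[p.carrier] E ∧ MeasurableSet[p.carrier] F := by
    rintro E F ⟨p, hp, hE⟩ ⟨q, hq, hF⟩
    obtain ⟨r, hr, hpr, hqr⟩ := hc2 p hp q hq
    exact ⟨r, hr, hpr.1 _ hE, hqr.1 _ hF⟩
  have : Nonempty (PartialLowerDensity μ) := ⟨p₀⟩
  choose! P hP hPE using hm
  let ψ : Set X → Set X := fun E => (P E).toFun E
  have hψ : ∀ p ∈ c, ∀ E, MeasurableSet[p.carrier] E → p.toFun E = ψ E := by
    intro p hp E hE
    have hEm : MeasurableSet[m] E := ⟨p, hp, hE⟩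
    obtain ⟨r, hr, hpr, hPr⟩ := hc2 p hp (P E) (hP E hEm)
    rw [hpr.2 E hE, ← hPr.2 E (hPE E hEm)]
  refine ⟨⟨m, ψ, ?_, ?_, ?_, ?_, ?_, ?_, ?_⟩, fun p hp => ⟨fun E hE => ⟨p, hp, hE⟩, hψ p hp⟩⟩
  · rintro E ⟨p, -, hE⟩
    exact p.carrier_le _ hE
  · intro E hE
    exact ⟨P E, hP E hE, (P E).isLowerDensity.measurableSet _ (hPE E hE)⟩
  · rw [← hψ p₀ hp₀ _ (@MeasurableSet.empty _ p₀.carrier), p₀.isLowerDensity.map_empty]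
  · rw [← hψ p₀ hp₀ _ (@MeasurableSet.univ _ p₀.carrier), p₀.isLowerDensity.map_univ]
  · intro E F hE hF
    obtain ⟨p, hp, hE, hF⟩ := hm2 E F hE hF
    rw [← hψ p hp _ hE, ← hψ p hp _ hF, ← hψ p hp _ (hE.inter hF),
      p.isLowerDensity.map_inter _ _ hE hF]
  · intro E F hE hF hEF
    obtain ⟨p, hp, hE, hF⟩ := hm2 E F hE hF
    rw [← hψ p hp _ hE, ← hψ p hp _ hF, p.isLowerDensity.congr_ae _ _ hE hF hEF]
  · intro E hE
    exact (P E).isLowerDensity.ae_mem_iff _ (hPE E hE)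

theorem exists_upper_bound_of_isChain [IsFiniteMeasure μ] (hμ : μ ≠ 0)
    {c : Set (PartialLowerDensity μ)} (hc : IsChain Extends c) :
    ∃ q, ∀ p ∈ c, Extends p q := by
  have total : ∀ p ∈ c, ∀ q ∈ c, Extends p q ∨ Extends q p := by
    intro p hp q hq
    by_cases hpq : p = q
    · exact .inl (hpq ▸ .refl p)
    · exact hc hp hq hpq
  by_cases hcof : ∃ s ⊆ c, s.Countable ∧ ∀ p ∈ c, ∃ q ∈ s, Extends p q
  · obtain ⟨s, hsc, hs, hcof⟩ := hcof
    rcases s.eq_empty_or_nonempty with rfl | hne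
    · refine ⟨⟨⊥, id, bot_le, IsLowerDensity_s0.id_bot hμ⟩, fun p hp => ?_⟩
      obtain ⟨q, hq, -⟩ := hcof p hp
      exact hq.elim
    obtain ⟨f, rfl⟩ := hs.exists_eq_range hne
    have hub : ∀ p q : c, ∃ r : c, Extends p.1 r.1 ∧ Extends q.1 r.1 := by
      intro p q
      rcases total p p.2 q q.2 with h | h
      · exact ⟨q, h, .refl _⟩
      · exact ⟨p, .refl _, h⟩
    choose ub hub₁ hub₂ using hub
    let f' : ℕ → c := fun n => ⟨f n, hsc (mem_range_self n)⟩
    let g : ℕ → c := fun n => Nat.rec (f' 0) (fun k r => ub r (f' (k + 1))) n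
    have hfg : ∀ n, Extends (f n) (g n).1 := by
      rintro (_ | n)
      · exact .refl _
      · exact hub₂ (g n) (f' (n + 1))
    obtain ⟨q, hq⟩ := exists_upper_bound_seq (fun n => (g n).1)
      fun n => hub₁ (g n) (f' (n + 1))
    refine ⟨q, fun p hp => ?_⟩
    obtain ⟨_, ⟨n, rfl⟩, hn⟩ := hcof p hp
    exact hn.trans ((hfg n).trans (hq n))
  · push Not at hcof
    refine exists_upper_bound_of_countably_directed fun s hsc hs => ?_
    obtain ⟨q, hq, hqs⟩ := hcof s hsc hs
    exact ⟨q, hq, fun p hp => (total p (hsc hp) q hq).resolve_right (hqs p hp)⟩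

end PartialLowerDensity

open PartialLowerDensity in
/-- A nonzero finite measure has a lower density. -/
theorem exists_isLowerDensity {μ : Measure X} [IsFiniteMeasure μ] (hμ : μ ≠ 0) :
    ∃ φ, IsLowerDensity_s0 μ m0 φ := by
  obtain ⟨p, hp⟩ := exists_maximal_of_chains_bounded (r := Extends (μ := μ))
    (fun c hc => exists_upper_bound_of_isChain hμ hc) Extends.trans
  suffices hm : p.carrier = m0 from ⟨p.toFun, by
    have := p.isLowerDensity
    rwa [hm] at this⟩
  refine le_antisymm p.carrier_le fun A hA => ?_
  obtain ⟨ψ, hψ, hext⟩ := p.isLowerDensity.exists_adjoin p.carrier_le hA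
  have hle : p.carrier.adjoin A ≤ m0 := by
    rintro _ ⟨E, F, hE, hF, rfl⟩
    exact ((p.carrier_le _ hE).inter hA).union ((p.carrier_le _ hF).diff hA)
  have := hp ⟨p.carrier.adjoin A, ψ, hle, hψ⟩ ⟨fun E hE => ⟨E, E, hE, hE, by simp⟩, hext⟩
  exact this.1 A ⟨univ, ∅, @MeasurableSet.univ _ p.carrier, @MeasurableSet.empty _ p.carrier, by simp⟩

end Zorn

/-- **von Neumann–Maharam theorem.** Every complete σ-finite nonzero measure admits a
von Neumann lifting. -/
theorem exists_vonNeumann_lifting {X : Type*} [MeasurableSpace X] (μ : Measure X)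
    [SigmaFinite μ] (hc : μ.IsComplete) (hμ : μ ≠ 0) :
    ∃ ℓ : Set X → Set X, IsVNLifting μ ℓ := by
  have hae : ae μ.toFinite = ae μ := ae_toFinite
  have hμ' : μ.toFinite ≠ 0 := by
    rwa [← ae_neBot, hae, ae_neBot]
  obtain ⟨φ, hφ⟩ := exists_isLowerDensity hμ'
  refine IsLowerDensity_s0.exists_isVNLifting (φ := φ) hc ⟨hφ.measurableSet, hφ.map_empty,
    hφ.map_univ, hφ.map_inter, ?_, ?_⟩
  · simpa only [hae] using hφ.congr_ae
  · simpa only [hae] using hφ.ae_mem_iff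
end

section
/- Let (X, Σ, μ) be a measure space and ℓ a von Neumann lifting of μ. Then there exists a unique linear continuous map ℓ : L∞(μ) → ℒ∞(Σ) such that ℓ(π_μ(1_E)) = 1_{ℓ(E)} for every E ∈ Σ. Moreover this operator satisfies: π_μ(ℓ(f)) = f for every f ∈ L∞(μ); ℓ(fg) = ℓ(f)ℓ(g) for every f, g ∈ L∞(μ); and ‖ℓ(f)‖_{ℒ∞(Σ)} = ‖f‖_{L∞(μ)} for every f ∈ L∞(μ). -/
open MeasureTheory Set

theorem ae_abs_le_norm_Linfty {X : Type*} [MeasurableSpace X] {μ : Measure X}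
    (f : Lp ℝ ⊤ μ) : ∀ᵐ x ∂μ, |f x| ≤ ‖f‖ := by
  have hfin : eLpNormEssSup f μ ≠ ⊤ := by
    simpa only [eLpNorm_exponent_top] using (Lp.memLp f).eLpNorm_ne_top
  filter_upwards [ae_le_eLpNormEssSup (f := f) (μ := μ)] with x hx
  rw [Lp.norm_def, eLpNorm_exponent_top, ← Real.norm_eq_abs, ← toReal_enorm]
  exact ENNReal.toReal_mono hfin hx

theorem norm_Linfty_le_of_ae_abs_le {X : Type*} [MeasurableSpace X] {μ : Measure X}
    {f : Lp ℝ ⊤ μ} {C : ℝ} (hC : 0 ≤ C) (h : ∀ᵐ x ∂μ, |f x| ≤ C) :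
    ‖f‖ ≤ C := by
  rw [Lp.norm_def, eLpNorm_exponent_top]
  exact ENNReal.toReal_le_of_le_ofReal hC (eLpNormEssSup_le_of_ae_bound h)

theorem measurableSet_lt_Linfty {X : Type*} [MeasurableSpace X] {μ : Measure X}
    (f : Lp ℝ ⊤ μ) (r : ℝ) : MeasurableSet {y | r < f y} :=
  (Lp.stronglyMeasurable f).measurable measurableSet_Ioi

namespace IsVNLifting

variable {X : Type*} [MeasurableSpace X] {μ : Measure X} {ℓ : Set X → Set X}

theorem mono (hℓ : IsVNLifting μ ℓ) {E F : Set X} (hE : MeasurableSet E) (hF : MeasurableSet F)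
    (h : E ⊆ F) : ℓ E ⊆ ℓ F := by
  have := hℓ.map_inter E F hE hF
  rw [inter_eq_left.2 h] at this
  rw [this]
  exact inter_subset_right

theorem mem_or_mem_compl (hℓ : IsVNLifting μ ℓ) {E : Set X} (hE : MeasurableSet E) (x : X) :
    x ∈ ℓ E ∨ x ∈ ℓ Eᶜ := by
  have := hℓ.map_union E Eᶜ hE hE.compl
  rw [union_compl_self, hℓ.map_univ] at this
  exact this.subset (mem_univ x)

/-- The filter of sets containing a measurable set whose lifting contains `x`. -/
def pointFilter (hℓ : IsVNLifting μ ℓ) (x : X) : Filter X where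
  sets := {S | ∃ E, MeasurableSet E ∧ x ∈ ℓ E ∧ E ⊆ S}
  univ_sets := ⟨univ, .univ, by rw [hℓ.map_univ]; trivial, subset_rfl⟩
  sets_of_superset := fun ⟨E, hE, hx, hS⟩ hST => ⟨E, hE, hx, hS.trans hST⟩
  inter_sets := fun ⟨E, hE, hx, hS⟩ ⟨F, hF, hx', hT⟩ =>
    ⟨E ∩ F, hE.inter hF, by rw [hℓ.map_inter E F hE hF]; exact ⟨hx, hx'⟩, inter_subset_inter hS hT⟩

theorem mem_pointFilter (hℓ : IsVNLifting μ ℓ) {E : Set X} (hE : MeasurableSet E) {x : X} :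
    E ∈ hℓ.pointFilter x ↔ x ∈ ℓ E :=
  ⟨fun ⟨_, hF, hx, h⟩ => hℓ.mono hF hE h hx, fun h => ⟨E, hE, h, subset_rfl⟩⟩

instance pointFilter_neBot (hℓ : IsVNLifting μ ℓ) (x : X) : (hℓ.pointFilter x).NeBot := by
  rw [Filter.neBot_iff, ne_eq, ← Filter.empty_mem_iff_bot, hℓ.mem_pointFilter .empty, hℓ.map_empty]
  exact notMem_empty x

theorem pointFilter_le_ae (hℓ : IsVNLifting μ ℓ) (x : X) : hℓ.pointFilter x ≤ ae μ := by
  intro S hS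
  obtain ⟨N, hN, hNm, hN0⟩ := exists_measurable_superset_of_null (mem_ae_iff.1 hS)
  refine ⟨Nᶜ, hNm.compl, ?_, compl_subset_comm.1 hN⟩
  rw [hℓ.congr_ae Nᶜ univ hNm.compl .univ (by simpa using hN0), hℓ.map_univ]
  trivial

theorem exists_tendsto (hℓ : IsVNLifting μ ℓ) (f : Lp ℝ ⊤ μ) (x : X) :
    ∃ a, Filter.Tendsto f (hℓ.pointFilter x) (nhds a) := by
  have hbd : Filter.map f (hℓ.pointFilter x) ≤ Filter.principal (Icc (-‖f‖) ‖f‖) := by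
    rw [Filter.le_principal_iff, Filter.mem_map]
    filter_upwards [hℓ.pointFilter_le_ae x (ae_abs_le_norm_Linfty f)] with y hy
    exact abs_le.1 hy
  obtain ⟨a, -, ha⟩ := isCompact_Icc hbd
  refine ⟨a, Metric.nhds_basis_ball.tendsto_right_iff.2 fun ε hε => ?_⟩
  have hm : MeasurableSet (f ⁻¹' Metric.ball a ε) :=
    (Lp.stronglyMeasurable f).measurable measurableSet_ball
  refine (hℓ.mem_pointFilter hm).2 ((hℓ.mem_or_mem_compl hm x).resolve_right fun h => ?_)
  have hc : (Metric.ball a ε)ᶜ ∈ Filter.map f (hℓ.pointFilter x) :=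
    (hℓ.mem_pointFilter hm.compl).2 h
  obtain ⟨y, hy, hy'⟩ := clusterPt_iff_nonempty.1 ha (Metric.ball_mem_nhds a hε) hc
  exact hy' hy

/-- The lifting of functions induced by a lifting of sets. -/
noncomputable def lift (hℓ : IsVNLifting μ ℓ) (f : Lp ℝ ⊤ μ) (x : X) : ℝ :=
  (hℓ.exists_tendsto f x).choose

theorem tendsto_lift (hℓ : IsVNLifting μ ℓ) (f : Lp ℝ ⊤ μ) (x : X) :
    Filter.Tendsto f (hℓ.pointFilter x) (nhds (hℓ.lift f x)) :=
  (hℓ.exists_tendsto f x).choose_spec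

theorem lift_eq_of_tendsto (hℓ : IsVNLifting μ ℓ) {f : Lp ℝ ⊤ μ} {g : X → ℝ} {x : X} {a : ℝ}
    (hfg : f =ᵐ[μ] g) (hg : Filter.Tendsto g (hℓ.pointFilter x) (nhds a)) : hℓ.lift f x = a :=
  tendsto_nhds_unique (hℓ.tendsto_lift f x) (hg.congr' (hℓ.pointFilter_le_ae x hfg.symm))

theorem lift_add (hℓ : IsVNLifting μ ℓ) (f g : Lp ℝ ⊤ μ) :
    hℓ.lift (f + g) = hℓ.lift f + hℓ.lift g :=
  funext fun x => hℓ.lift_eq_of_tendsto (Lp.coeFn_add f g)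
    ((hℓ.tendsto_lift f x).add (hℓ.tendsto_lift g x))

theorem lift_smul (hℓ : IsVNLifting μ ℓ) (c : ℝ) (f : Lp ℝ ⊤ μ) :
    hℓ.lift (c • f) = c • hℓ.lift f :=
  funext fun x => hℓ.lift_eq_of_tendsto (Lp.coeFn_smul c f) ((hℓ.tendsto_lift f x).const_smul c)

theorem lift_mul (hℓ : IsVNLifting μ ℓ) {f g h : Lp ℝ ⊤ μ} (hfg : h =ᵐ[μ] fun x => f x * g x) :
    hℓ.lift h = fun x => hℓ.lift f x * hℓ.lift g x :=
  funext fun x => hℓ.lift_eq_of_tendsto hfg ((hℓ.tendsto_lift f x).mul (hℓ.tendsto_lift g x))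

theorem abs_lift_le (hℓ : IsVNLifting μ ℓ) (f : Lp ℝ ⊤ μ) (x : X) : |hℓ.lift f x| ≤ ‖f‖ :=
  le_of_tendsto (hℓ.tendsto_lift f x).abs (hℓ.pointFilter_le_ae x (ae_abs_le_norm_Linfty f))

theorem lift_indicator (hℓ : IsVNLifting μ ℓ) {E : Set X} (hE : MeasurableSet E) {f : Lp ℝ ⊤ μ}
    (hf : f =ᵐ[μ] E.indicator 1) : hℓ.lift f = (ℓ E).indicator 1 := by
  funext x
  refine hℓ.lift_eq_of_tendsto hf (tendsto_const_nhds.congr' ?_)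
  by_cases hx : x ∈ ℓ E
  · filter_upwards [(hℓ.mem_pointFilter hE).2 hx] with y hy
    simp [hx, hy]
  · filter_upwards [(hℓ.mem_pointFilter hE.compl).2
      ((hℓ.mem_or_mem_compl hE x).resolve_left hx)] with y hy
    rw [indicator_of_notMem hx, indicator_of_notMem hy]

theorem mem_of_lt_lift (hℓ : IsVNLifting μ ℓ) {f : Lp ℝ ⊤ μ} {r : ℝ} {x : X}
    (h : r < hℓ.lift f x) : x ∈ ℓ {y | r < f y} :=
  (hℓ.mem_pointFilter (measurableSet_lt_Linfty f r)).1 ((hℓ.tendsto_lift f x).eventually_const_lt h)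

theorem le_lift_of_mem (hℓ : IsVNLifting μ ℓ) {f : Lp ℝ ⊤ μ} {r : ℝ} {x : X}
    (h : x ∈ ℓ {y | r < f y}) : r ≤ hℓ.lift f x :=
  ge_of_tendsto (hℓ.tendsto_lift f x) <| by
    filter_upwards [(hℓ.mem_pointFilter (measurableSet_lt_Linfty f r)).2 h] with y hy
    exact le_of_lt hy

theorem measurable_lift (hℓ : IsVNLifting μ ℓ) (f : Lp ℝ ⊤ μ) : Measurable (hℓ.lift f) := by
  refine measurable_of_Ioi fun q => ?_
  have : hℓ.lift f ⁻¹' Ioi q = ⋃ (r : ℚ) (_ : q < r), ℓ {y | (r : ℝ) < f y} := by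
    ext x
    simp only [mem_preimage, mem_Ioi, mem_iUnion, exists_prop]
    constructor
    · intro h
      obtain ⟨r, hqr, hr⟩ := exists_rat_btwn h
      exact ⟨r, hqr, hℓ.mem_of_lt_lift hr⟩
    · rintro ⟨r, hqr, hr⟩
      exact hqr.trans_le (hℓ.le_lift_of_mem hr)
  rw [this]
  exact .iUnion fun r => .iUnion fun _ => hℓ.measurableSet _ (measurableSet_lt_Linfty f r)

theorem lift_ae_eq (hℓ : IsVNLifting μ ℓ) (f : Lp ℝ ⊤ μ) : hℓ.lift f =ᵐ[μ] f := by
  have h : ∀ᵐ x ∂μ, ∀ r : ℚ, (r : ℝ) < f x ↔ x ∈ ℓ {y | (r : ℝ) < f y} :=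
    ae_all_iff.2 fun r => Filter.eventuallyEq_set.1 <|
      measure_symmDiff_eq_zero_iff.1 (hℓ.ae_symmDiff _ (measurableSet_lt_Linfty f r))
  filter_upwards [h] with x hx
  apply le_antisymm
  · refine le_of_forall_rat_lt_imp_le fun r hr => ?_
    exact ((hx r).2 (hℓ.mem_of_lt_lift hr)).le
  · exact le_of_forall_rat_lt_imp_le fun r hr => hℓ.le_lift_of_mem ((hx r).1 hr)

theorem iSup_abs_lift (hℓ : IsVNLifting μ ℓ) (f : Lp ℝ ⊤ μ) : (⨆ x, |hℓ.lift f x|) = ‖f‖ := by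
  apply le_antisymm
  · exact Real.iSup_le (hℓ.abs_lift_le f) (norm_nonneg f)
  · refine norm_Linfty_le_of_ae_abs_le (Real.iSup_nonneg fun x => abs_nonneg _) ?_
    filter_upwards [hℓ.lift_ae_eq f] with x hx
    rw [← hx]
    exact le_ciSup (f := fun x => |hℓ.lift f x|)
      ⟨‖f‖, forall_mem_range.2 (hℓ.abs_lift_le f)⟩ x

end IsVNLifting

/-- A measurable function is uniformly approximated by simple functions where it is bounded. -/
theorem exists_simpleFunc_abs_sub_le {X : Type*} [MeasurableSpace X] {f : X → ℝ}
    (hf : Measurable f) (M : ℝ) {ε : ℝ} (hε : 0 < ε) :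
    ∃ s : SimpleFunc X ℝ, ∀ x, |f x| ≤ M → |f x - s x| ≤ ε := by
  have hk : Measurable fun x => ⌊max (-M) (min M (f x)) / ε⌋ := by fun_prop
  have hg : Measurable fun x => ε * (⌊max (-M) (min M (f x)) / ε⌋ : ℝ) := by fun_prop
  refine ⟨⟨fun x => ε * (⌊max (-M) (min M (f x)) / ε⌋ : ℝ),
    fun y => hg (measurableSet_singleton y), ?_⟩, fun x hx => ?_⟩
  · refine ((finite_Icc ⌊-M / ε⌋ ⌊max (-M) M / ε⌋).image fun k : ℤ => ε * (k : ℝ)).subset ?_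
    rintro _ ⟨x, rfl⟩
    refine ⟨_, ⟨?_, ?_⟩, rfl⟩
    · exact Int.floor_le_floor (by gcongr; exact le_max_left _ _)
    · exact Int.floor_le_floor (by gcongr; exact min_le_left _ _)
  · obtain ⟨h₁, h₂⟩ := abs_le.1 hx
    change |f x - ε * (⌊max (-M) (min M (f x)) / ε⌋ : ℝ)| ≤ ε
    rw [min_eq_right h₂, max_eq_right h₁]
    have h₃ := Int.floor_le (f x / ε)
    have h₄ := (Int.lt_floor_add_one (f x / ε)).le
    rw [le_div_iff₀ hε] at h₃
    rw [div_le_iff₀ hε] at h₄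
    rw [abs_le]
    constructor <;> linarith

/-- A bounded linear map on `L∞` vanishing on indicators vanishes. -/
theorem eq_zero_of_indicator_eq_zero {X : Type*} [MeasurableSpace X] {μ : Measure X}
    {D : Lp ℝ ⊤ μ → ℝ} (hadd : ∀ f g, D (f + g) = D f + D g)
    (hsmul : ∀ (c : ℝ) f, D (c • f) = c * D f)
    {C : ℝ} (hC : ∀ f, |D f| ≤ C * ‖f‖)
    (hind : ∀ E : Set X, MeasurableSet E → ∀ f : Lp ℝ ⊤ μ, f =ᵐ[μ] E.indicator 1 → D f = 0)
    (f : Lp ℝ ⊤ μ) : D f = 0 := by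
  have hs : ∀ s : SimpleFunc X ℝ, D (s.memLp_top μ).toLp = 0 := by
    intro s
    induction s using SimpleFunc.induction with
    | @const c E hE =>
      have hi : MemLp (E.indicator (1 : X → ℝ)) ⊤ μ :=
        (memLp_top_const (1 : ℝ)).indicator hE
      have : (SimpleFunc.memLp_top (.piecewise E hE (.const X c) (.const X 0)) μ).toLp =
          c • hi.toLp := by
        rw [← MemLp.toLp_const_smul, MemLp.toLp_eq_toLp_iff]
        refine .of_forall fun x => ?_
        by_cases hx : x ∈ E <;> simp [hx]
      rw [this, hsmul, hind E hE _ hi.coeFn_toLp, mul_zero]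
    | @add s t _ hs ht =>
      have : ((s + t).memLp_top μ).toLp = (s.memLp_top μ).toLp + (t.memLp_top μ).toLp :=
        MemLp.toLp_add (s.memLp_top μ) (t.memLp_top μ)
      rw [this, hadd, hs, ht, add_zero]
  have hC' : |D f| ≤ 0 := by
    refine le_of_forall_pos_le_add fun δ hδ => ?_
    have hpos : 0 < |C| + 1 := by positivity
    obtain ⟨s, hsf⟩ := exists_simpleFunc_abs_sub_le (Lp.stronglyMeasurable f).measurable ‖f‖
      (div_pos hδ hpos)
    set g : Lp ℝ ⊤ μ := (s.memLp_top μ).toLp with hg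
    have hn : ‖f - g‖ ≤ δ / (|C| + 1) := by
      refine norm_Linfty_le_of_ae_abs_le (by positivity) ?_
      filter_upwards [Lp.coeFn_sub f g, (s.memLp_top μ).coeFn_toLp,
        ae_abs_le_norm_Linfty f] with x h₁ h₂ h₃
      rw [h₁, Pi.sub_apply, hg, h₂]
      exact hsf x h₃
    have hD : D f = D (f - g) := by
      conv_lhs => rw [← sub_add_cancel f g, hadd, hs s, add_zero]
    calc |D f| = |D (f - g)| := by rw [hD]
      _ ≤ C * ‖f - g‖ := hC _
      _ ≤ (|C| + 1) * (δ / (|C| + 1)) := by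
        gcongr
        linarith [le_abs_self C]
      _ = 0 + δ := by field_simp; ring
  exact abs_nonpos_iff.1 hC'

/-- **Lifting of functions.** A von Neumann lifting of sets induces a unique linear continuous
lifting `L∞(μ) → ℒ∞(Σ)` sending the class of `1_E` to `1_{ℓ E}`; moreover this lifting selects
representatives, is multiplicative, and preserves the (sup-)norm. -/
theorem lifting_of_functions {X : Type*} [MeasurableSpace X] (μ : Measure X)
    (ℓ : Set X → Set X) (hℓ : IsVNLifting μ ℓ) :
    ∃ L : Lp ℝ ⊤ μ → X → ℝ,
      ((∀ f g : Lp ℝ ⊤ μ, L (f + g) = L f + L g) ∧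
        (∀ (c : ℝ) (f : Lp ℝ ⊤ μ), L (c • f) = c • L f) ∧
        (∀ f : Lp ℝ ⊤ μ, Measurable (L f)) ∧
        (∃ C : ℝ, ∀ (f : Lp ℝ ⊤ μ) (x : X), |L f x| ≤ C * ‖f‖) ∧
        (∀ E : Set X, MeasurableSet E → ∀ f : Lp ℝ ⊤ μ,
          (f : X → ℝ) =ᵐ[μ] E.indicator 1 → L f = (ℓ E).indicator 1)) ∧
      (∀ L' : Lp ℝ ⊤ μ → X → ℝ,
        ((∀ f g : Lp ℝ ⊤ μ, L' (f + g) = L' f + L' g) ∧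
          (∀ (c : ℝ) (f : Lp ℝ ⊤ μ), L' (c • f) = c • L' f) ∧
          (∀ f : Lp ℝ ⊤ μ, Measurable (L' f)) ∧
          (∃ C : ℝ, ∀ (f : Lp ℝ ⊤ μ) (x : X), |L' f x| ≤ C * ‖f‖) ∧
          (∀ E : Set X, MeasurableSet E → ∀ f : Lp ℝ ⊤ μ,
            (f : X → ℝ) =ᵐ[μ] E.indicator 1 → L' f = (ℓ E).indicator 1)) → L' = L) ∧
      (∀ f : Lp ℝ ⊤ μ, L f =ᵐ[μ] f) ∧
      (∀ f g h : Lp ℝ ⊤ μ,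
        ((h : X → ℝ) =ᵐ[μ] fun x => (f : X → ℝ) x * (g : X → ℝ) x) →
        L h = fun x => L f x * L g x) ∧
      (∀ f : Lp ℝ ⊤ μ, (⨆ x : X, |L f x|) = ‖f‖) := by
  refine ⟨hℓ.lift, ⟨hℓ.lift_add, hℓ.lift_smul, hℓ.measurable_lift,
    ⟨1, fun f x => by simpa using hℓ.abs_lift_le f x⟩, fun E hE f hf => hℓ.lift_indicator hE hf⟩,
    ?_, hℓ.lift_ae_eq, fun f g h hfg => hℓ.lift_mul hfg, hℓ.iSup_abs_lift⟩
  rintro L' ⟨hadd, hsmul, -, ⟨C, hC⟩, hind⟩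
  funext f x
  refine sub_eq_zero.1 (eq_zero_of_indicator_eq_zero (D := fun f => L' f x - hℓ.lift f x)
    (C := C + 1) (fun f g => ?_) (fun c f => ?_) (fun f => ?_) (fun E hE f hf => ?_) f)
  · simp only [hadd, hℓ.lift_add, Pi.add_apply]
    ring
  · simp only [hsmul, hℓ.lift_smul, Pi.smul_apply, smul_eq_mul]
    ring
  · linarith [abs_sub (L' f x) (hℓ.lift f x), hC f x, hℓ.abs_lift_le f x]
  · rw [hind E hE f hf, hℓ.lift_indicator hE hf, sub_self]
end

section
/- Let (X, Σ, μ) be a complete σ-finite measure space, (Y, d) a metric space, and ℓ a von Neumann lifting of μ. Let φ : X → Y be an essentially separably valued measurable map. Then for μ-a.e. x ∈ X it holds that lim_{I ⇒ x} ⨍_I d(φ(·), φ(x)) dμ = 0, where the limit is taken with respect to the differentiation basis 𝓘^ℓ. -/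
open MeasureTheory Set

/-- The differentiation basis `𝓘^ℓ` induced by a lifting `ℓ`: all sets `ℓ E` with
`E` measurable of positive finite measure. -/
def liftBasis {X : Type*} [MeasurableSpace X] (μ : MeasureTheory.Measure X)
    (ℓ : Set X → Set X) : Set (Set X) :=
  {I | ∃ E : Set X, MeasurableSet E ∧ 0 < μ E ∧ μ E < ⊤ ∧ I = ℓ E}

/-- `HasDLim ℐ x Φ y` means `lim_{I ⇒ x} Φ(I) = y` along the differentiation basis `ℐ`:
for every neighbourhood `U` of `y` there is `I ∈ ℐ_x` with `Φ J ∈ U` for every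
`J ∈ ℐ_x` with `J ⊆ I`. -/
def HasDLim {X Y : Type*} [TopologicalSpace Y] (ℐ : Set (Set X)) (x : X)
    (Φ : Set X → Y) (y : Y) : Prop :=
  ∀ U ∈ nhds y, ∃ I ∈ ℐ, x ∈ I ∧ ∀ J ∈ ℐ, x ∈ J → J ⊆ I → Φ J ∈ U

theorem IsVNLifting.ae_mem {X : Type*} [MeasurableSpace X] {μ : Measure X}
    {ℓ : Set X → Set X} (hℓ : IsVNLifting μ ℓ) {E : Set X} (hE : MeasurableSet E) :
    ∀ᵐ x ∂μ, x ∈ E ↔ x ∈ ℓ E :=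
  (measure_symmDiff_eq_zero_iff.1 (hℓ.ae_symmDiff E hE)).mem_iff

theorem IsVNLifting.measure_eq {X : Type*} [MeasurableSpace X] {μ : Measure X}
    {ℓ : Set X → Set X} (hℓ : IsVNLifting μ ℓ) {E : Set X} (hE : MeasurableSet E) :
    μ (ℓ E) = μ E :=
  (measure_congr (measure_symmDiff_eq_zero_iff.1 (hℓ.ae_symmDiff E hE))).symm

theorem IsVNLifting.measure_pos_of_mem {X : Type*} [MeasurableSpace X] {μ : Measure X}
    {ℓ : Set X → Set X} (hℓ : IsVNLifting μ ℓ) {E : Set X} (hE : MeasurableSet E) {x : X}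
    (hx : x ∈ ℓ E) : 0 < μ E := by
  refine pos_iff_ne_zero.2 fun h => ?_
  have hE' : ℓ E = ∅ := by
    rw [hℓ.congr_ae E ∅ hE MeasurableSet.empty (by simpa using h), hℓ.map_empty]
  simp [hE'] at hx

theorem norm_setAverage_le_of_norm_le_const_ae {X E : Type*} [MeasurableSpace X]
    [NormedAddCommGroup E] [NormedSpace ℝ E] {μ : Measure X} {s : Set X} {f : X → E} {C : ℝ}
    (hs0 : μ s ≠ 0) (hs : μ s < ⊤) (hf : ∀ᵐ x ∂μ.restrict s, ‖f x‖ ≤ C) :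
    ‖⨍ x in s, f x ∂μ‖ ≤ C := by
  have hpos : 0 < μ.real s := ENNReal.toReal_pos hs0 hs.ne
  rw [setAverage_eq, norm_smul, norm_inv, Real.norm_of_nonneg hpos.le, inv_mul_le_iff₀ hpos,
    mul_comm]
  exact norm_setIntegral_le_of_norm_le_const_ae hs hf

/-- **Metric-valued Lebesgue differentiation theorem.** For an essentially separably valued
measurable map `φ` into a metric space, for μ-a.e. `x` the averages `⨍_I d(φ(·), φ(x)) dμ`
converge to `0` along the differentiation basis induced by a von Neumann lifting. -/
theorem metric_valued_lebesgue_differentiation {X Y : Type*} [MeasurableSpace X]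
    [MetricSpace Y] [MeasurableSpace Y] [BorelSpace Y]
    (μ : Measure X) [SigmaFinite μ] (hc : μ.IsComplete)
    (ℓ : Set X → Set X) (hℓ : IsVNLifting μ ℓ)
    (φ : X → Y) (hφ : Measurable φ)
    (hsep : ∃ N : Set X, MeasurableSet N ∧ μ N = 0 ∧
      TopologicalSpace.IsSeparable (φ '' Nᶜ)) :
    ∀ᵐ x ∂μ,
      HasDLim (liftBasis μ ℓ) x (fun I => ⨍ z in I, dist (φ z) (φ x) ∂μ) 0 := by
  obtain ⟨N, -, hN, C, hC, hNC⟩ := hsep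
  have hball : ∀ᵐ x ∂μ, ∀ c ∈ C, ∀ k : ℕ,
      x ∈ φ ⁻¹' Metric.ball c (1 / (k + 1)) ↔ x ∈ ℓ (φ ⁻¹' Metric.ball c (1 / (k + 1))) :=
    (ae_ball_iff hC).2 fun c _ => ae_all_iff.2 fun k => hℓ.ae_mem (hφ measurableSet_ball)
  have hspan : ∀ᵐ x ∂μ, ∀ m : ℕ, x ∈ spanningSets μ m ↔ x ∈ ℓ (spanningSets μ m) :=
    ae_all_iff.2 fun m => hℓ.ae_mem (measurableSet_spanningSets μ m)
  filter_upwards [hball, hspan, measure_eq_zero_iff_ae_notMem.1 hN] with x hx hxS hxN U hU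
  obtain ⟨ε, hε, hεU⟩ := Metric.mem_nhds_iff.1 hU
  obtain ⟨k, hk⟩ := exists_nat_one_div_lt (half_pos hε)
  obtain ⟨c, hc, hxc⟩ := Metric.mem_closure_iff.1 (hNC (mem_image_of_mem φ hxN))
    (1 / (k + 1)) Nat.one_div_pos_of_nat
  set B := φ ⁻¹' Metric.ball c (1 / (k + 1))
  have hBm : MeasurableSet B := hφ measurableSet_ball
  set S := spanningSets μ (spanningSetsIndex μ x)
  have hSm : MeasurableSet S := measurableSet_spanningSets μ _
  have hxI : x ∈ ℓ (B ∩ S) := by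
    rw [hℓ.map_inter B S hBm hSm]
    exact ⟨(hx c hc k).1 hxc, (hxS _).1 (mem_spanningSetsIndex μ x)⟩
  refine ⟨ℓ (B ∩ S), ⟨B ∩ S, hBm.inter hSm, hℓ.measure_pos_of_mem (hBm.inter hSm) hxI,
    (measure_mono inter_subset_right).trans_lt (measure_spanningSets_lt_top μ _), rfl⟩, hxI, ?_⟩
  rintro _ ⟨E, hE, hE0, hEtop, rfl⟩ - hEI
  rw [← hℓ.measure_eq hE] at hE0 hEtop
  refine hεU (mem_ball_zero_iff.2 ((norm_setAverage_le_of_norm_le_const_ae hE0.ne' hEtop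
    (C := 2 * (1 / (k + 1))) ?_).trans_lt (by linarith)))
  rw [ae_restrict_iff' (hℓ.measurableSet E hE)]
  filter_upwards [hℓ.ae_mem (hBm.inter hSm)] with z hz hzE
  have hzc : dist (φ z) c < 1 / (k + 1) := (hz.2 (hEI hzE)).1
  rw [Real.norm_of_nonneg dist_nonneg]
  linarith [dist_triangle_right (φ z) (φ x) c]
end

section
/- Let (X, Σ, μ) be a complete σ-finite measure space and ℓ a von Neumann lifting of μ. Let 𝔹 be a Banach space and v : X → 𝔹 a strongly measurable map. Then for μ-a.e. x ∈ X the Bochner averages ⨍_I v dμ converge to v(x) along the differentiation basis 𝓘^ℓ, i.e. v(x) = lim_{I ⇒ x} ⨍_I v dμ in the norm of 𝔹. -/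
open MeasureTheory Set

namespace IsVNLifting

variable {X : Type*} [MeasurableSpace X] {μ : Measure X} {ℓ : Set X → Set X}

lemma ae_eq (hℓ : IsVNLifting μ ℓ) {E : Set X} (hE : MeasurableSet E) : E =ᵐ[μ] ℓ E :=
  measure_symmDiff_eq_zero_iff.mp (hℓ.ae_symmDiff E hE)

lemma ae_mem_lift (hℓ : IsVNLifting μ ℓ) {E : Set X} (hE : MeasurableSet E) :
    ∀ᵐ x ∂μ, x ∈ E → x ∈ ℓ E :=
  (hℓ.ae_eq hE).le

lemma measure_lift (hℓ : IsVNLifting μ ℓ) {E : Set X} (hE : MeasurableSet E) :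
    μ (ℓ E) = μ E :=
  (measure_congr (hℓ.ae_eq hE)).symm

lemma measure_pos_of_mem_s4 (hℓ : IsVNLifting μ ℓ) {E : Set X} (hE : MeasurableSet E) {x : X}
    (hx : x ∈ ℓ E) : 0 < μ E := by
  refine pos_iff_ne_zero.mpr fun h => ?_
  have h_empty : ℓ E = ℓ ∅ := hℓ.congr_ae E ∅ hE MeasurableSet.empty (by simpa using h)
  rw [h_empty, hℓ.map_empty] at hx
  exact hx

lemma ae_restrict_mem_of_subset_lift (hℓ : IsVNLifting μ ℓ) {E J : Set X}
    (hE : MeasurableSet E) (hJ : MeasurableSet J) (hJE : J ⊆ ℓ E) :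
    ∀ᵐ x ∂μ.restrict J, x ∈ E := by
  rw [ae_restrict_iff' hJ]
  filter_upwards [(hℓ.ae_eq hE).symm.le] with x hx hxJ
  exact hx (hJE hxJ)

end IsVNLifting

/-- **Banach-valued Lebesgue differentiation theorem.** For a strongly measurable map `v`
into a Banach space, for μ-a.e. `x` the Bochner averages `⨍_I v dμ` converge to `v x`
along the differentiation basis induced by a von Neumann lifting. -/
theorem banach_valued_lebesgue_differentiation {X B : Type*} [MeasurableSpace X]
    [NormedAddCommGroup B] [NormedSpace ℝ B] [CompleteSpace B]
    (μ : Measure X) [SigmaFinite μ] (hc : μ.IsComplete)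
    (ℓ : Set X → Set X) (hℓ : IsVNLifting μ ℓ)
    (v : X → B) (hv : StronglyMeasurable v) :
    ∀ᵐ x ∂μ, HasDLim (liftBasis μ ℓ) x (fun I => ⨍ z in I, v z ∂μ) (v x) := by
  borelize B
  obtain ⟨c, hc_count, hc_dense⟩ := hv.isSeparable_range
  set r : ℕ → ℝ := fun m => 1 / ((m : ℝ) + 1)
  have h_meas : ∀ b m, MeasurableSet (v ⁻¹' Metric.ball b (r m)) :=
    fun b m => hv.measurable Metric.isOpen_ball.measurableSet
  have h_ball : ∀ᵐ x ∂μ, ∀ b ∈ c, ∀ m : ℕ,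
      x ∈ v ⁻¹' Metric.ball b (r m) → x ∈ ℓ (v ⁻¹' Metric.ball b (r m)) :=
    (ae_ball_iff hc_count).mpr fun b _ => ae_all_iff.mpr fun m => hℓ.ae_mem_lift (h_meas b m)
  have h_span : ∀ᵐ x ∂μ, ∀ k : ℕ, x ∈ spanningSets μ k → x ∈ ℓ (spanningSets μ k) :=
    ae_all_iff.mpr fun k => hℓ.ae_mem_lift (measurableSet_spanningSets μ k)
  filter_upwards [h_ball, h_span] with x hx_ball hx_span U hU
  obtain ⟨ε, hε, hεU⟩ := Metric.mem_nhds_iff.mp hU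
  obtain ⟨m, hm⟩ := exists_nat_one_div_lt (half_pos hε)
  have hm : r m < ε / 2 := hm
  have hr : 0 < r m := Nat.one_div_pos_of_nat
  obtain ⟨b, hbc, hb⟩ := Metric.mem_closure_iff.mp (hc_dense (mem_range_self x)) (r m) hr
  obtain ⟨k, hk⟩ := mem_iUnion.mp ((iUnion_spanningSets μ).symm ▸ mem_univ x)
  have hS := measurableSet_spanningSets μ k
  set E := v ⁻¹' Metric.ball b (r m)
  have hE : MeasurableSet E := h_meas b m
  have hI : ℓ (E ∩ spanningSets μ k) = ℓ E ∩ ℓ (spanningSets μ k) := hℓ.map_inter _ _ hE hS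
  have hxI : x ∈ ℓ (E ∩ spanningSets μ k) := hI ▸ ⟨hx_ball b hbc m hb, hx_span k hk⟩
  refine ⟨_, ⟨E ∩ spanningSets μ k, hE.inter hS, hℓ.measure_pos_of_mem_s4 (hE.inter hS) hxI,
    (measure_mono inter_subset_right).trans_lt (measure_spanningSets_lt_top μ k), rfl⟩, hxI, ?_⟩
  rintro J ⟨F, hF, hF_pos, hF_top, rfl⟩ - hJI
  have hJ_top : μ (ℓ F) < ⊤ := by rwa [hℓ.measure_lift hF]
  have hJ_mem : ∀ᵐ z ∂μ.restrict (ℓ F), v z ∈ Metric.closedBall b (r m) := by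
    filter_upwards [hℓ.ae_restrict_mem_of_subset_lift hE (hℓ.measurableSet F hF)
      (hJI.trans (hI ▸ inter_subset_left))] with z hz
    exact Metric.ball_subset_closedBall hz
  have hv_int : IntegrableOn v (ℓ F) μ := by
    refine IntegrableOn.of_bound hJ_top hv.aestronglyMeasurable (‖b‖ + r m) ?_
    filter_upwards [hJ_mem] with z hz
    exact norm_le_of_mem_closedBall hz
  have h_avg : ⨍ z in ℓ F, v z ∂μ ∈ Metric.closedBall b (r m) :=
    (convex_closedBall b (r m)).set_average_mem Metric.isClosed_closedBall
      (by rw [hℓ.measure_lift hF]; exact hF_pos.ne') hJ_top.ne hJ_mem hv_int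
  apply hεU
  rw [Metric.mem_ball]
  have h_tri := dist_triangle_right (⨍ z in ℓ F, v z ∂μ) (v x) b
  have h_avg := Metric.mem_closedBall.mp h_avg
  linarith
end

section
/- Let (X, τ_X) and (Y, τ_Y) be Polish spaces and φ : X → Y a Borel measurable map. Let 𝔹 be a Banach space and Ω a 𝔹-valued measure on (X, 𝓑(X)) of bounded variation. If {Ω_y}_{y∈Y} and {Ω'_y}_{y∈Y} are both disintegrations of Ω along φ, then Ω_y = Ω'_y for φ_#‖Ω‖_𝔹-a.e. y ∈ Y. -/
open MeasureTheory Set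

/-- The variation `‖Ω‖_B` of a vector measure `Ω`, evaluated on a set `E`: the supremum of
`Σᵢ ‖Ω Eᵢ‖` over all finite measurable partitions of `E`. -/
noncomputable def vmVariation {X B : Type*} [MeasurableSpace X] [NormedAddCommGroup B]
    (Ω : MeasureTheory.VectorMeasure X B) (E : Set X) : ENNReal :=
  ⨆ (P : Finset (Set X)) (_ : (∀ A ∈ P, MeasurableSet A) ∧
      ((P : Set (Set X)).PairwiseDisjoint id) ∧ ⋃₀ (P : Set (Set X)) = E),
    ∑ A ∈ P, (‖Ω A‖₊ : ENNReal)
/-- `Ωy` is a disintegration of the vector measure `Ω` along `φ`, where `ν` is the variation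
measure `‖Ω‖_B`: each `Ωy y` has bounded variation; for `φ_#ν`-a.e. `y` it has total
variation `1` and is concentrated on the fibre `φ⁻¹ {y}`; and for every measurable set `E`
the map `y ↦ Ωy y E` is (a.e.) strongly measurable and integrable with
`Ω E = ∫ Ωy y E d(φ_#ν)(y)`. -/
def IsDisintegrationOn {X Y B : Type*} [MeasurableSpace X] [MeasurableSpace Y]
    [NormedAddCommGroup B] [NormedSpace ℝ B] [CompleteSpace B]
    (φ : X → Y) (Ω : MeasureTheory.VectorMeasure X B) (ν : MeasureTheory.Measure X)
    (Ωy : Y → MeasureTheory.VectorMeasure X B) : Prop :=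
  (∀ y, vmVariation (Ωy y) Set.univ < ⊤) ∧
  (∀ᵐ y ∂(ν.map φ), vmVariation (Ωy y) Set.univ = 1 ∧
      vmVariation (Ωy y) ((φ ⁻¹' {y})ᶜ) = 0) ∧
  (∀ E : Set X, MeasurableSet E →
      MeasureTheory.AEStronglyMeasurable (fun y => Ωy y E) (ν.map φ) ∧
      MeasureTheory.Integrable (fun y => Ωy y E) (ν.map φ)) ∧
  (∀ E : Set X, MeasurableSet E → Ω E = ∫ y, Ωy y E ∂(ν.map φ))

/-- A vector measure vanishes on the measurable subsets of a set of zero variation. -/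
lemma vectorMeasure_eq_zero_of_vmVariation_eq_zero {X B : Type*} [MeasurableSpace X]
    [NormedAddCommGroup B] {Ω : VectorMeasure X B} {S E : Set X} (hS : MeasurableSet S)
    (h : vmVariation Ω S = 0) (hE : MeasurableSet E) (hES : E ⊆ S) : Ω E = 0 := by
  classical
  let P : Finset (Set X) := {E, S \ E}
  have hP : (∀ A ∈ P, MeasurableSet A) ∧
      ((P : Set (Set X)).PairwiseDisjoint id) ∧ ⋃₀ (P : Set (Set X)) = S := by
    refine ⟨?_, ?_, ?_⟩
    · simp [P, hE, hS.diff hE]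
    · simpa [P, Set.pairwiseDisjoint_insert] using fun _ => Set.disjoint_sdiff_right
    · simp [P, Set.union_eq_right.2 hES]
  have hle : ∑ A ∈ P, (‖Ω A‖₊ : ENNReal) ≤ 0 :=
    h ▸ le_iSup₂ (f := fun (P : Finset (Set X)) (_ : (∀ A ∈ P, MeasurableSet A) ∧
      ((P : Set (Set X)).PairwiseDisjoint id) ∧ ⋃₀ (P : Set (Set X)) = S) =>
        ∑ A ∈ P, (‖Ω A‖₊ : ENNReal)) P hP
  have h0 := Finset.sum_eq_zero_iff.1 (nonpos_iff_eq_zero.1 hle) E (by simp [P])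
  simpa using h0

/-- A disintegration of `Ω` along `φ` recovers `Ω (E ∩ φ ⁻¹' F)` by integrating over `F`. -/
lemma IsDisintegrationOn.setIntegral_eq {X Y B : Type*} [MeasurableSpace X] [MeasurableSpace Y]
    [MeasurableSingletonClass Y] [NormedAddCommGroup B] [NormedSpace ℝ B] [CompleteSpace B]
    {φ : X → Y} (hφ : Measurable φ) {Ω : VectorMeasure X B} {ν : Measure X}
    {Ωy : Y → VectorMeasure X B} (h : IsDisintegrationOn φ Ω ν Ωy) {E : Set X}
    (hE : MeasurableSet E) {F : Set Y} (hF : MeasurableSet F) :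
    ∫ y in F, Ωy y E ∂(ν.map φ) = Ω (E ∩ φ ⁻¹' F) := by
  obtain ⟨-, hfib, -, hint⟩ := h
  rw [hint _ (hE.inter (hφ hF)), ← integral_indicator hF]
  refine integral_congr_ae ?_
  filter_upwards [hfib] with y hy
  have hnull {A : Set X} (hA : MeasurableSet A) (hAy : A ⊆ (φ ⁻¹' {y})ᶜ) : Ωy y A = 0 :=
    vectorMeasure_eq_zero_of_vmVariation_eq_zero (hφ (measurableSet_singleton y)).compl hy.2 hA hAy
  by_cases hyF : y ∈ F
  · rw [Set.indicator_of_mem hyF, ← (Ωy y).of_add_of_sdiff (hE.inter (hφ hF)) hE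
      inter_subset_left, hnull (hE.diff (hE.inter (hφ hF))), add_zero]
    rintro x ⟨hxE, hx⟩ rfl
    exact hx ⟨hxE, hyF⟩
  · rw [Set.indicator_of_notMem hyF, hnull (hE.inter (hφ hF))]
    rintro x ⟨-, hx⟩ rfl
    exact hyF hx

/-- **Uniqueness of the disintegration.** Two disintegrations of a `B`-valued measure of
bounded variation along a Borel map between Polish spaces agree `φ_#‖Ω‖_B`-almost
everywhere. -/
theorem disintegration_unique {X Y B : Type*}
    [TopologicalSpace X] [PolishSpace X] [MeasurableSpace X] [BorelSpace X]
    [TopologicalSpace Y] [PolishSpace Y] [MeasurableSpace Y] [BorelSpace Y]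
    [NormedAddCommGroup B] [NormedSpace ℝ B] [CompleteSpace B]
    (φ : X → Y) (hφ : Measurable φ)
    (Ω : VectorMeasure X B) (hBV : vmVariation Ω Set.univ < ⊤)
    (ν : Measure X) (hν : ∀ E : Set X, MeasurableSet E → ν E = vmVariation Ω E)
    (Ω₁ Ω₂ : Y → VectorMeasure X B)
    (h₁ : IsDisintegrationOn φ Ω ν Ω₁) (h₂ : IsDisintegrationOn φ Ω ν Ω₂) :
    ∀ᵐ y ∂(ν.map φ), Ω₁ y = Ω₂ y := by
  obtain ⟨b, hbc, hb⟩ := MeasurableSpace.CountablyGenerated.isCountablyGenerated (α := X)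
  have hgen : ‹MeasurableSpace X› = MeasurableSpace.generateFrom (generateSetAlgebra b) := by
    rw [generateFrom_generateSetAlgebra_eq, ← hb]
  have hmeas {E : Set X} (hE : E ∈ generateSetAlgebra b) : MeasurableSet E := by
    rw [hgen]
    exact MeasurableSpace.measurableSet_generateFrom hE
  have hae : ∀ᵐ y ∂(ν.map φ), ∀ E ∈ generateSetAlgebra b, Ω₁ y E = Ω₂ y E := by
    rw [ae_ball_iff (countable_generateSetAlgebra hbc)]
    intro E hE
    refine Integrable.ae_eq_of_forall_setIntegral_eq _ _ (h₁.2.2.1 E (hmeas hE)).2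
      (h₂.2.2.1 E (hmeas hE)).2 fun F hF _ => ?_
    rw [h₁.setIntegral_eq hφ (hmeas hE) hF, h₂.setIntegral_eq hφ (hmeas hE) hF]
  filter_upwards [hae] with y hy
  exact VectorMeasure.ext_of_generateFrom _ hy hgen
    (fun s hs t ht _ => isSetAlgebra_generateSetAlgebra.inter_mem hs ht)
    (hy _ isSetAlgebra_generateSetAlgebra.univ_mem)
end

section
/- Let (X, τ_X) and (Y, τ_Y) be Polish spaces and φ : X → Y a Borel measurable map. Let 𝔹 be a Banach space having the Radon–Nikodým property and Ω a 𝔹-valued measure on (X, 𝓑(X)) of bounded variation. Then there exists a disintegration {Ω_y}_{y∈Y} of Ω along φ. -/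
open MeasureTheory Set

/-- The Banach space `B` has the Radon–Nikodým property: every `B`-valued measure of bounded
variation on a σ-finite measure space that is absolutely continuous with respect to the
measure admits a Bochner-integrable density. -/
def HasRNP (B : Type*) [NormedAddCommGroup B] [NormedSpace ℝ B] : Prop :=
  ∀ (Z : Type) (_ : MeasurableSpace Z) (μ : MeasureTheory.Measure Z),
    MeasureTheory.SigmaFinite μ →
    ∀ Θ : MeasureTheory.VectorMeasure Z B, vmVariation Θ Set.univ < ⊤ →
      (∀ N : Set Z, MeasurableSet N → μ N = 0 → Θ N = 0) →
      ∃ w : Z → B, MeasureTheory.Integrable w μ ∧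
        ∀ E : Set Z, MeasurableSet E → Θ E = ∫ z in E, w z ∂μ

open scoped ENNReal

/-- On measurable sets, `vmVariation` agrees with Mathlib's variation measure. -/
theorem vmVariation_eq_variation {X B : Type*} [MeasurableSpace X] [NormedAddCommGroup B]
    (Ω : VectorMeasure X B) {E : Set X} (hE : MeasurableSet E) :
    vmVariation Ω E = Ω.variation E := by
  apply le_antisymm
  · refine iSup₂_le fun P ⟨_, hdisj, hunion⟩ => ?_
    exact Ω.le_variation hE (fun t ht => hunion ▸ subset_sUnion_of_mem ht) hdisj
  · refine le_of_forall_lt fun a ha => ?_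
    obtain ⟨P, hsub, hdisj, hmeas, hlt⟩ := Ω.exists_lt_sum_of_lt_variation hE ha
    classical
    have hunion : MeasurableSet (⋃₀ (P : Set (Set X))) :=
      MeasurableSet.sUnion P.countable_toSet fun t ht => hmeas t ht
    refine hlt.trans_le ((Finset.sum_le_sum_of_subset
      (Finset.subset_insert (E \ ⋃₀ (P : Set (Set X))) P)).trans ?_)
    refine le_iSup₂ (f := fun (P : Finset (Set X)) (_ : (∀ A ∈ P, MeasurableSet A) ∧
      ((P : Set (Set X)).PairwiseDisjoint id) ∧ ⋃₀ (P : Set (Set X)) = E) =>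
        ∑ A ∈ P, (‖Ω A‖₊ : ℝ≥0∞)) (insert (E \ ⋃₀ (P : Set (Set X))) P) ⟨?_, ?_, ?_⟩
    · intro A hA
      rcases Finset.mem_insert.1 hA with rfl | hA
      · exact hE.diff hunion
      · exact hmeas A hA
    · rw [Finset.coe_insert]
      refine hdisj.insert fun t ht _ => ?_
      exact disjoint_sdiff_left.mono_right (subset_sUnion_of_mem ht)
    · rw [Finset.coe_insert, sUnion_insert, sdiff_union_self]
      exact union_eq_left.2 (sUnion_subset fun t ht => hsub t ht)

/-- In a space with the Radon–Nikodým property, a vector measure of finite variation on a standard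
Borel space (in any universe) has a density with respect to its variation. -/
theorem HasRNP.exists_withDensityᵥ_variation_eq {X B : Type*} [MeasurableSpace X]
    [StandardBorelSpace X] [NormedAddCommGroup B] [NormedSpace ℝ B]
    (hRNP : HasRNP B) (Ω : VectorMeasure X B) [IsFiniteMeasure Ω.variation] :
    ∃ W : X → B, Integrable W Ω.variation ∧ Ω.variation.withDensityᵥ W = Ω := by
  have hf := measurableEmbedding_embeddingReal X
  set f := embeddingReal X
  obtain ⟨w, hw, hΩ⟩ := hRNP ℝ inferInstance (Ω.variation.map f) inferInstance (Ω.map f)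
    (by
      rw [vmVariation_eq_variation _ MeasurableSet.univ]
      exact measure_lt_top _ _)
    (fun N hN hN0 => by
      rw [← enorm_eq_zero, ← nonpos_iff_eq_zero, ← hN0, ← hf.variation_map]
      exact VectorMeasure.enorm_measure_le_variation _ N)
  have hwf : Integrable (w ∘ f) Ω.variation := hf.integrable_map_iff.1 hw
  refine ⟨w ∘ f, hwf, ?_⟩
  ext E hE
  have hpre : f ⁻¹' (f '' E) = E := preimage_image_eq _ hf.injective
  have hΩE := hΩ (f '' E) (hf.measurableSet_image.2 hE)
  rw [VectorMeasure.map_apply _ hf.measurable (hf.measurableSet_image.2 hE), hpre,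
    hf.setIntegral_map, hpre] at hΩE
  rw [withDensityᵥ_apply hwf hE, hΩE]
  rfl

/-- The density of a vector measure with respect to its own variation has norm one almost
everywhere. -/
theorem enorm_ae_eq_one_of_withDensityᵥ_variation_eq {X B : Type*} [MeasurableSpace X]
    [NormedAddCommGroup B] [NormedSpace ℝ B] [CompleteSpace B]
    (Ω : VectorMeasure X B) [IsFiniteMeasure Ω.variation] {W : X → B}
    (hW : Integrable W Ω.variation) (hΩ : Ω.variation.withDensityᵥ W = Ω) :
    ∀ᵐ x ∂Ω.variation, ‖W x‖ₑ = 1 := by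
  have h := Measure.variation_withDensityᵥ hW
  rw [hΩ] at h
  refine (withDensity_eq_iff hW.1.enorm aemeasurable_const hW.2.ne).1 ?_
  rw [← h]
  exact withDensity_one.symm

/-- **Existence of the disintegration for vector-valued measures.** Every measure of bounded
variation with values in a Banach space with the Radon–Nikodým property admits a
disintegration along any Borel map between Polish spaces. -/
theorem disintegration_exists {X Y B : Type*}
    [TopologicalSpace X] [PolishSpace X] [MeasurableSpace X] [BorelSpace X]
    [TopologicalSpace Y] [PolishSpace Y] [MeasurableSpace Y] [BorelSpace Y]
    [NormedAddCommGroup B] [NormedSpace ℝ B] [CompleteSpace B]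
    (hRNP : HasRNP B)
    (φ : X → Y) (hφ : Measurable φ)
    (Ω : VectorMeasure X B) (hBV : vmVariation Ω Set.univ < ⊤)
    (ν : Measure X) (hν : ∀ E : Set X, MeasurableSet E → ν E = vmVariation Ω E) :
    ∃ Ωy : Y → VectorMeasure X B, IsDisintegrationOn φ Ω ν Ωy := by
  obtain rfl : ν = Ω.variation :=
    Measure.ext fun E hE => (hν E hE).trans (vmVariation_eq_variation Ω hE)
  have : IsFiniteMeasure Ω.variation :=
    ⟨by rwa [← vmVariation_eq_variation Ω MeasurableSet.univ]⟩
  rcases isEmpty_or_nonempty X with hX | hX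
  · have hΩ : Ω = 0 := by
      ext E _
      simp [eq_empty_of_isEmpty E]
    subst hΩ
    refine ⟨0, fun y => ?_, ?_, ?_, ?_⟩
    · simp [vmVariation_eq_variation]
    all_goals simp
  obtain ⟨W, hW, hΩW⟩ := hRNP.exists_withDensityᵥ_variation_eq Ω
  have hW1 := enorm_ae_eq_one_of_withDensityᵥ_variation_eq Ω hW hΩW
  set ν := Ω.variation
  have hg : Measurable fun x => (φ x, x) := hφ.prodMk measurable_id
  set ρ : Measure (Y × X) := ν.map fun x => (φ x, x) with hρ
  have hfst : ρ.fst = ν.map φ := Measure.fst_map_prodMk measurable_id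
  have hρdis : ρ.fst.compProd ρ.condKernel = ρ := ρ.disintegrate ρ.condKernel
  have hemb : MeasurableEmbedding fun x => (φ x, x) :=
    hg.measurableEmbedding fun x y h => congrArg Prod.snd h
  have hWρ : Integrable (fun p : Y × X => W p.2) ρ := hemb.integrable_map_iff.2 hW
  have hWy : ∀ᵐ y ∂ν.map φ, Integrable W (ρ.condKernel y) := hfst ▸ hWρ.condKernel_ae
  have hnorm : ∀ᵐ y ∂ν.map φ, ∀ᵐ x ∂ρ.condKernel y, ‖W x‖ₑ = 1 := by
    have h : ∀ᵐ p ∂ρ, ‖W p.2‖ₑ = 1 := hemb.ae_map_iff.2 hW1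
    rw [← hρdis] at h
    exact hfst ▸ Measure.ae_ae_of_ae_compProd h
  have hfib : ∀ᵐ y ∂ν.map φ, ∀ᵐ x ∂ρ.condKernel y, φ x = y := by
    have h : ∀ᵐ p ∂ρ, φ p.2 = p.1 := hemb.ae_map_iff.2 (ae_of_all _ fun _ => rfl)
    rw [← hρdis] at h
    exact hfst ▸ Measure.ae_ae_of_ae_compProd h
  have hWE : ∀ E : Set X, MeasurableSet E → Integrable (fun p : Y × X => E.indicator W p.2) ρ :=
    fun E hE => hemb.integrable_map_iff.2 (hW.indicator hE)
  have happly : ∀ E : Set X, MeasurableSet E →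
      (fun y => (ρ.condKernel y).withDensityᵥ W E) =ᵐ[ν.map φ]
        fun y => ∫ x, E.indicator W x ∂ρ.condKernel y := by
    intro E hE
    filter_upwards [hWy] with y hy
    rw [withDensityᵥ_apply hy hE, integral_indicator hE]
  have hint : ∀ E : Set X, MeasurableSet E →
      Integrable (fun y => (ρ.condKernel y).withDensityᵥ W E) (ν.map φ) := fun E hE =>
    (hfst ▸ (hWE E hE).integral_condKernel).congr (happly E hE).symm
  refine ⟨fun y => (ρ.condKernel y).withDensityᵥ W, fun y => ?_, ?_,
    fun E hE => ⟨(hint E hE).1, hint E hE⟩, fun E hE => ?_⟩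
  · rw [vmVariation_eq_variation _ MeasurableSet.univ]
    by_cases hy : Integrable W (ρ.condKernel y)
    · rw [Measure.variation_withDensityᵥ hy, withDensity_apply _ MeasurableSet.univ,
        Measure.restrict_univ]
      exact hy.2
    · simp [Measure.withDensityᵥ, hy]
  · filter_upwards [hWy, hnorm, hfib] with y hy hy1 hyφ
    have hmeas : MeasurableSet (φ ⁻¹' {y})ᶜ := (hφ (measurableSet_singleton y)).compl
    rw [vmVariation_eq_variation _ MeasurableSet.univ, vmVariation_eq_variation _ hmeas,
      Measure.variation_withDensityᵥ hy, withDensity_congr_ae hy1]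
    refine ⟨?_, ?_⟩
    · simp
    · rw [withDensity_const, one_smul]
      exact hyφ
  · rw [integral_congr_ae (happly E hE), ← hfst, Measure.integral_condKernel (hWE E hE), hρ,
      hemb.integral_map, integral_indicator hE, ← withDensityᵥ_apply hW hE, hΩW]
end

section
/- Let (X, Σ, μ) be a complete measure space and φ a lower density of μ. Then there exists a von Neumann lifting ℓ of μ such that φ(E) ⊆ ℓ(E) ⊆ X ∖ φ(X ∖ E) for every E ∈ Σ. -/
open MeasureTheory Set

/-- A lower density of a measure `μ`: like a von Neumann lifting, except that preservation
of finite unions is not required. -/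
structure IsLowerDensity {X : Type*} [MeasurableSpace X] (μ : Measure X)
    (φ : Set X → Set X) : Prop where
  measurableSet : ∀ E : Set X, MeasurableSet E → MeasurableSet (φ E)
  map_empty : φ (∅ : Set X) = ∅
  map_univ : φ (Set.univ : Set X) = Set.univ
  map_inter : ∀ E F : Set X, MeasurableSet E → MeasurableSet F → φ (E ∩ F) = φ E ∩ φ F
  congr_ae : ∀ E F : Set X, MeasurableSet E → MeasurableSet F →
    μ (symmDiff E F) = 0 → φ E = φ F
  ae_symmDiff : ∀ E : Set X, MeasurableSet E → μ (symmDiff E (φ E)) = 0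

namespace IsLowerDensity

variable {X : Type*} [MeasurableSpace X] {μ : Measure X} {φ : Set X → Set X}

theorem ae_eq (hφ : IsLowerDensity μ φ) {E : Set X} (hE : MeasurableSet E) :
    φ E =ᵐ[μ] E :=
  (measure_symmDiff_eq_zero_iff.1 (hφ.ae_symmDiff E hE)).symm

/-- The filter of sets containing a measurable set whose lower density contains `x`. -/
def filterAt (hφ : IsLowerDensity μ φ) (x : X) : Filter X where
  sets := {A | ∃ E ⊆ A, MeasurableSet E ∧ x ∈ φ E}
  univ_sets := ⟨univ, Subset.rfl, .univ, hφ.map_univ.symm.subset (mem_univ x)⟩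
  sets_of_superset := fun ⟨E, hEA, hE⟩ hAB => ⟨E, hEA.trans hAB, hE⟩
  inter_sets := fun ⟨E, hEA, hE, hxE⟩ ⟨F, hFB, hF, hxF⟩ =>
    ⟨E ∩ F, inter_subset_inter hEA hFB, hE.inter hF,
      (hφ.map_inter E F hE hF).symm ▸ ⟨hxE, hxF⟩⟩

theorem mem_filterAt (hφ : IsLowerDensity μ φ) {x : X} {A : Set X} :
    A ∈ hφ.filterAt x ↔ ∃ E ⊆ A, MeasurableSet E ∧ x ∈ φ E :=
  Iff.rfl

instance filterAt_neBot (hφ : IsLowerDensity μ φ) (x : X) : (hφ.filterAt x).NeBot := by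
  refine ⟨fun h => ?_⟩
  obtain ⟨E, hE, -, hx⟩ := hφ.mem_filterAt.1 (Filter.empty_mem_iff_bot.2 h)
  rw [subset_empty_iff.1 hE, hφ.map_empty] at hx
  exact hx

theorem filterAt_le_ae (hφ : IsLowerDensity μ φ) (x : X) : hφ.filterAt x ≤ ae μ := by
  intro A hA
  obtain ⟨N, hN, hNm, hN0⟩ := exists_measurable_superset_of_null (mem_ae_iff.1 hA)
  refine hφ.mem_filterAt.2 ⟨Nᶜ, compl_subset_comm.1 hN, hNm.compl, ?_⟩
  rw [hφ.congr_ae Nᶜ univ hNm.compl .univ (by simpa [symmDiff_def] using hN0), hφ.map_univ]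
  exact mem_univ x

end IsLowerDensity

/-- **From lower density to lifting.** Every lower density of a complete measure can be
enlarged to a von Neumann lifting. -/
theorem exists_lifting_of_lowerDensity {X : Type*} [MeasurableSpace X]
    (μ : Measure X) (hc : μ.IsComplete)
    (φ : Set X → Set X) (hφ : IsLowerDensity μ φ) :
    ∃ ℓ : Set X → Set X, IsVNLifting μ ℓ ∧
      ∀ E : Set X, MeasurableSet E → φ E ⊆ ℓ E ∧ ℓ E ⊆ (φ Eᶜ)ᶜ := by
  let U : X → Ultrafilter X := fun x => Ultrafilter.of (hφ.filterAt x)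
  have hU : ∀ x, (U x : Filter X) ≤ hφ.filterAt x := fun x => Ultrafilter.of_le _
  let ℓ : Set X → Set X := fun E => {x | E ∈ U x}
  have lower : ∀ E, MeasurableSet E → φ E ⊆ ℓ E := fun E hE x hx =>
    hU x (hφ.mem_filterAt.2 ⟨E, Subset.rfl, hE, hx⟩)
  have upper : ∀ E, MeasurableSet E → ℓ E ⊆ (φ Eᶜ)ᶜ := fun E hE x hx hx' =>
    Ultrafilter.compl_mem_iff_notMem.1 (lower Eᶜ hE.compl hx') hx
  have ae_eq : ∀ E, MeasurableSet E → ℓ E =ᵐ[μ] E := fun E hE => by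
    have h := (hφ.ae_eq hE.compl).compl
    rw [compl_compl] at h
    exact ((upper E hE).eventuallyLE.trans h.le).antisymm
      ((hφ.ae_eq hE).symm.le.trans (lower E hE).eventuallyLE)
  refine ⟨ℓ, ⟨fun E hE => ?_, ?_, ?_, fun E F _ _ => ?_, fun E F _ _ => ?_,
    fun E F _ _ h => ?_, fun E hE => ?_⟩, fun E hE => ⟨lower E hE, upper E hE⟩⟩
  · exact (hE.nullMeasurableSet.congr (ae_eq E hE).symm).measurable_of_complete
  · ext x
    simp [ℓ]
  · exact eq_univ_of_forall fun x => Filter.univ_mem (f := (U x : Filter X))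
  · ext x
    exact Filter.inter_mem_iff
  · ext x
    exact Ultrafilter.union_mem_iff
  · ext x
    exact Filter.congr_sets (((hU x).trans (hφ.filterAt_le_ae x))
      ((measure_symmDiff_eq_zero_iff.1 h).mem_iff))
  · exact measure_symmDiff_eq_zero_iff.2 (ae_eq E hE).symm
end
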